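/- Let m ≥ 1 be an integer and n = (n₁,…,n_m) ∈ ℕ^m a multi-index. Let J(x) = Σ_{0 ≤ i ≤ n} J_i ∏_{j=1}^m x_j^{i_j} be a real polynomial in m variables, where the sum ranges over all multi-indices i = (i₁,…,i_m) with 0 ≤ i_j ≤ n_j for all j, and J_i ∈ ℝ are its monomial coefficients. Then J admits the Bernstein expansion J(x) = Σ_{0 ≤ i ≤ n} β_i B_{i,n}(x), where the Bernstein coefficients are given by β_i = Σ_{0 ≤ k ≤ i} (∏_{j=1}^m C(i_j,k_j)/C(n_j,k_j)) · J_k for every multi-index i with 0 ≤ i ≤ n. -/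

import Mathlib

/-- The multivariate Bernstein basis polynomial `B_{i,n}(x)`, where the multi-index `i`
satisfies `0 ≤ i_j ≤ n_j` for all `j` (encoded as `i j : Fin (n j + 1)`). -/
noncomputable def bernsteinBasis (m : ℕ) (n : Fin m → ℕ)
    (i : (j : Fin m) → Fin (n j + 1)) (x : Fin m → ℝ) : ℝ :=
  ∏ j : Fin m,
    ((n j).choose (i j) : ℝ) * x j ^ (i j : ℕ) * (1 - x j) ^ (n j - (i j : ℕ))

/-- The moment identity `∑ i, C(i, k) / C(n, k) * B_{i,n}(t) = t ^ k` in one variable. -/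
theorem sum_choose_div_choose_mul_bernstein {n k : ℕ} (hk : k ≤ n) (t : ℝ) :
    ∑ i : Fin (n + 1), ((i : ℕ).choose k : ℝ) / (n.choose k : ℝ) *
      ((n.choose i : ℝ) * t ^ (i : ℕ) * (1 - t) ^ (n - (i : ℕ))) = t ^ k := by
  obtain ⟨d, rfl⟩ := Nat.exists_eq_add_of_le hk
  have hc : ((k + d).choose k : ℝ) ≠ 0 := by
    exact_mod_cast (Nat.choose_pos hk).ne'
  rw [Fin.sum_univ_eq_sum_range fun i : ℕ ↦ (i.choose k : ℝ) / ((k + d).choose k : ℝ) *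
      (((k + d).choose i : ℝ) * t ^ i * (1 - t) ^ (k + d - i)), add_assoc,
    Finset.sum_range_add, Finset.sum_eq_zero, zero_add]
  · have hterm (j : ℕ) (hj : j ∈ Finset.range (d + 1)) :
        ((k + j).choose k : ℝ) / ((k + d).choose k : ℝ) *
          (((k + d).choose (k + j) : ℝ) * t ^ (k + j) * (1 - t) ^ (k + d - (k + j))) =
        t ^ k * (t ^ j * (1 - t) ^ (d - j) * (d.choose j : ℝ)) := by
      have hchoose : ((k + d).choose (k + j) : ℝ) * ((k + j).choose k : ℝ) =
          ((k + d).choose k : ℝ) * (d.choose j : ℝ) := by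
        have := Nat.choose_mul (n := k + d) (k := k + j) (s := k) (Nat.le_add_right k j)
        rw [Nat.add_sub_cancel_left, Nat.add_sub_cancel_left] at this
        exact_mod_cast this
      rw [Nat.add_sub_add_left, pow_add]
      field_simp
      linear_combination t ^ k * t ^ j * (1 - t) ^ (d - j) * hchoose
    rw [Finset.sum_congr rfl hterm, ← Finset.mul_sum, ← add_pow, add_sub_cancel, one_pow, mul_one]
  · intro i hi
    simp [Nat.choose_eq_zero_of_lt (Finset.mem_range.mp hi)]

/-- A multi-index sum weighted by `∏ j, C(i j, k j)` over `k ≤ n` only sees the indices `k ≤ i`. -/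
theorem sum_castLE_choose_eq_sum (m : ℕ) (n : Fin m → ℕ)
    (J : ((j : Fin m) → Fin (n j + 1)) → ℝ) (i : (j : Fin m) → Fin (n j + 1)) :
    (∑ k : (j : Fin m) → Fin ((i j : ℕ) + 1),
      (∏ j : Fin m, ((i j : ℕ).choose (k j) : ℝ) / ((n j).choose (k j) : ℝ)) *
        J (fun j => Fin.castLE (Nat.succ_le_succ (Fin.is_le (i j))) (k j))) =
    ∑ k : (j : Fin m) → Fin (n j + 1),
      (∏ j : Fin m, ((i j : ℕ).choose (k j) : ℝ) / ((n j).choose (k j) : ℝ)) * J k := by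
  refine Fintype.sum_of_injective
    (fun k j ↦ Fin.castLE (Nat.succ_le_succ (Fin.is_le (i j))) (k j)) ?_ _ _ ?_ ?_
  · intro k l h
    funext j
    exact Fin.castLE_injective _ (congrFun h j)
  · intro k hk
    obtain ⟨j, hj⟩ : ∃ j, (i j : ℕ) < k j := by
      by_contra! h
      exact hk ⟨fun j ↦ ⟨k j, Nat.lt_succ_of_le (h j)⟩, rfl⟩
    rw [Finset.prod_eq_zero (Finset.mem_univ j), zero_mul]
    simp [Nat.choose_eq_zero_of_lt hj]
  · intro k
    rfl

/-- **Theorem (monomial-to-Bernstein coefficients).**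
For `m ≥ 1`, a multi-index `n ∈ ℕ^m`, and a polynomial
`J(x) = Σ_{0 ≤ i ≤ n} J_i Π_j x_j^{i_j}`, the Bernstein expansion
`J(x) = Σ_{0 ≤ i ≤ n} β_i B_{i,n}(x)` holds with
`β_i = Σ_{0 ≤ k ≤ i} (Π_j C(i_j,k_j)/C(n_j,k_j)) J_k`. -/
theorem monomial_to_bernstein (m : ℕ) (hm : 1 ≤ m) (n : Fin m → ℕ)
    (J : ((j : Fin m) → Fin (n j + 1)) → ℝ) (x : Fin m → ℝ) :
    (∑ i : (j : Fin m) → Fin (n j + 1), J i * ∏ j : Fin m, x j ^ (i j : ℕ)) =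
      ∑ i : (j : Fin m) → Fin (n j + 1),
        (∑ k : (j : Fin m) → Fin ((i j : ℕ) + 1),
          (∏ j : Fin m, ((i j : ℕ).choose (k j) : ℝ) / ((n j).choose (k j) : ℝ)) *
            J (fun j => Fin.castLE (Nat.succ_le_succ (Fin.is_le (i j))) (k j))) *
          bernsteinBasis m n i x := by
  simp_rw [sum_castLE_choose_eq_sum, Finset.sum_mul]
  rw [Finset.sum_comm]
  refine Finset.sum_congr rfl fun k _ ↦ ?_
  have hprod : ∏ j, x j ^ (k j : ℕ) = ∑ i : (j : Fin m) → Fin (n j + 1),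
      (∏ j, ((i j : ℕ).choose (k j) : ℝ) / ((n j).choose (k j) : ℝ)) *
        bernsteinBasis m n i x := by
    simp_rw [bernsteinBasis, ← Finset.prod_mul_distrib]
    rw [← Fintype.prod_sum fun j (a : Fin (n j + 1)) ↦
      ((a : ℕ).choose (k j) : ℝ) / ((n j).choose (k j) : ℝ) *
        (((n j).choose a : ℝ) * x j ^ (a : ℕ) * (1 - x j) ^ (n j - (a : ℕ)))]
    exact Finset.prod_congr rfl fun j _ ↦
      (sum_choose_div_choose_mul_bernstein (k j).is_le (x j)).symm
  rw [hprod, Finset.mul_sum]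
  exact Finset.sum_congr rfl fun i _ ↦ by ring
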